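/- Let φ be a flow on a generalized Peano continuum M and let Λ be a Lyapunov stable compact minimal set. If Λ is isolated from minimal sets, i.e., some neighborhood of Λ in M contains no compact minimal set other than Λ, then Λ is an attractor. -/

import Mathlib

open Set Filter Topology Metric TopologicalSpace

variable {M : Type*} [MetricSpace M]

/-- A set is invariant under the flow `φ`. -/
def IsFlowInvariant (φ : ℝ → M → M) (K : Set M) : Prop :=
  ∀ x ∈ K, ∀ t : ℝ, φ t x ∈ K

/-- A set is positively invariant under the flow `φ`. -/
def IsPosInvariant (φ : ℝ → M → M) (K : Set M) : Prop :=
  ∀ x ∈ K, ∀ t : ℝ, 0 ≤ t → φ t x ∈ K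

/-- A compact minimal set: nonempty, compact, invariant, with no nonempty proper
closed invariant subset. -/
def IsCompactMinimalSet (φ : ℝ → M → M) (K : Set M) : Prop :=
  K.Nonempty ∧ IsCompact K ∧ IsFlowInvariant φ K ∧
    ∀ K' ⊆ K, K'.Nonempty → IsClosed K' → IsFlowInvariant φ K' → K' = K

/-- Lyapunov stability: every neighborhood of `K` contains a positively invariant
neighborhood of `K`. -/
def IsLyapunovStable (φ : ℝ → M → M) (K : Set M) : Prop :=
  ∀ U ∈ 𝓝ˢ K, ∃ V ∈ 𝓝ˢ K, V ⊆ U ∧ IsPosInvariant φ V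

/-- The ω-limit set of a point. -/
def omegaLimitSet (φ : ℝ → M → M) (x : M) : Set M :=
  ⋂ T ∈ Ici (0 : ℝ), closure ((fun t => φ t x) '' Ici T)

/-- The α-limit set of a point. -/
def alphaLimitSet (φ : ℝ → M → M) (x : M) : Set M :=
  ⋂ T ∈ Iic (0 : ℝ), closure ((fun t => φ t x) '' Iic T)

/-- A compact minimal set is hyper-stable if some neighborhood of it in `M` meets no
Lyapunov unstable compact minimal set. -/
def IsHyperStable (φ : ℝ → M → M) (Λ : Set M) : Prop :=
  IsCompactMinimalSet φ Λ ∧ ∃ W ∈ 𝓝ˢ Λ, ∀ Γ : Set M,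
    IsCompactMinimalSet φ Γ → ¬ IsLyapunovStable φ Γ → Γ ∩ W = ∅

/-- An attractor: a Lyapunov stable nonempty compact invariant set whose basin of
attraction is a neighborhood of it. -/
def IsAttractorSet (φ : ℝ → M → M) (Δ : Set M) : Prop :=
  Δ.Nonempty ∧ IsCompact Δ ∧ IsFlowInvariant φ Δ ∧ IsLyapunovStable φ Δ ∧
    {x : M | (omegaLimitSet φ x).Nonempty ∧ omegaLimitSet φ x ⊆ Δ} ∈ 𝓝ˢ Δ

/-- The flow is non-wandering. -/
def IsNonWanderingFlow (φ : ℝ → M → M) : Prop :=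
  ∀ x : M, ∀ U ∈ 𝓝 x, ∀ T > (0 : ℝ), ∃ t ≥ T, ((fun y => φ t y) '' U ∩ U).Nonempty

/-- The set of hyper-stable compact minimal sets, as a subset of the space of nonempty
compact subsets of `M` (with the Hausdorff metric). -/
def HSset (φ : ℝ → M → M) : Set (NonemptyCompacts M) :=
  {Γ | IsHyperStable φ (Γ : Set M)}

/-- The set of all compact minimal sets, as a subset of the space of nonempty compact
subsets of `M` (with the Hausdorff metric). -/
def CMinSet (φ : ℝ → M → M) : Set (NonemptyCompacts M) :=
  {Γ | IsCompactMinimalSet φ (Γ : Set M)}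

/-- `basinOf φ X` is the set of points whose ω-limit set belongs to `X`. -/
def basinOf (φ : ℝ → M → M) (X : Set (NonemptyCompacts M)) : Set M :=
  {x | ∃ Γ ∈ X, (Γ : Set M) = omegaLimitSet φ x}

/-- The union in `M` of a family of hyper-stable compact minimal sets. -/
def unionSet (φ : ℝ → M → M) (X : Set ↥(HSset φ)) : Set M :=
  {y | ∃ q ∈ X, y ∈ ((q : NonemptyCompacts M) : Set M)}

/-- Every nonempty compact invariant set contains a compact minimal set. -/
theorem IsFlowInvariant.exists_isCompactMinimalSet_subset {φ : ℝ → M → M} {K : Set M}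
    (hinv : IsFlowInvariant φ K) (hK : IsCompact K) (hne : K.Nonempty) :
    ∃ Γ ⊆ K, IsCompactMinimalSet φ Γ := by
  obtain ⟨Γ, hΓK, hΓ⟩ := zorn_superset_nonempty
    {A : Set M | A ⊆ K ∧ A.Nonempty ∧ IsClosed A ∧ IsFlowInvariant φ A} (by
      intro c hc hchain hcne
      refine ⟨⋂₀ c, ⟨?_, ?_, ?_, ?_⟩, fun s hs => sInter_subset_of_mem hs⟩
      · obtain ⟨A, hA⟩ := hcne
        exact (sInter_subset_of_mem hA).trans (hc hA).1
      · have : Nonempty c := hcne.to_subtype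
        exact IsCompact.nonempty_sInter_of_directed_nonempty_isCompact_isClosed
          (fun A hA B hB => (hchain.total hA hB).elim (fun h => ⟨A, hA, Subset.rfl, h⟩)
            fun h => ⟨B, hB, h, Subset.rfl⟩) (fun A hA => (hc hA).2.1)
          (fun A hA => hK.of_isClosed_subset (hc hA).2.2.1 (hc hA).1)
          (fun A hA => (hc hA).2.2.1)
      · exact isClosed_sInter fun A hA => (hc hA).2.2.1
      · exact fun x hx t A hA => (hc hA).2.2.2 x (hx A hA) t)
    K ⟨Subset.rfl, hne, hK.isClosed, hinv⟩
  obtain ⟨-, hΓ_ne, hΓ_closed, hΓ_inv⟩ := hΓ.prop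
  refine ⟨Γ, hΓK, hΓ_ne, hK.of_isClosed_subset hΓ_closed hΓK, hΓ_inv, ?_⟩
  intro A hAΓ hA_ne hA_closed hA_inv
  exact hΓ.eq_of_subset ⟨hAΓ.trans hΓK, hA_ne, hA_closed, hA_inv⟩ hAΓ

theorem mem_omegaLimitSet {φ : ℝ → M → M} {x y : M} :
    y ∈ omegaLimitSet φ x ↔ ∀ T : ℝ, 0 ≤ T → y ∈ closure ((fun t => φ t x) '' Ici T) := by
  simp [omegaLimitSet]

theorem isClosed_omegaLimitSet (φ : ℝ → M → M) (x : M) : IsClosed (omegaLimitSet φ x) :=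
  isClosed_biInter fun _ _ => isClosed_closure

theorem omegaLimitSet_subset_of_isClosed {φ : ℝ → M → M} {x : M} {C : Set M} (hC : IsClosed C)
    {T : ℝ} (hT : 0 ≤ T) (h : ∀ t, T ≤ t → φ t x ∈ C) : omegaLimitSet φ x ⊆ C := fun _ hy =>
  closure_minimal (image_subset_iff.2 h) hC (mem_omegaLimitSet.1 hy T hT)

theorem isFlowInvariant_omegaLimitSet {φ : ℝ → M → M} (hcont : ∀ t, Continuous (φ t))
    (hadd : ∀ s t : ℝ, ∀ x : M, φ s (φ t x) = φ (s + t) x) (x : M) :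
    IsFlowInvariant φ (omegaLimitSet φ x) := by
  intro y hy t
  refine mem_omegaLimitSet.2 fun T _ => ?_
  refine map_mem_closure (hcont t) (mem_omegaLimitSet.1 hy (max 0 (T - t)) (le_max_left _ _)) ?_
  rintro _ ⟨s, hs, rfl⟩
  have hTs : T - t ≤ s := (le_max_right _ _).trans hs
  exact ⟨t + s, by rw [mem_Ici]; linarith, (hadd t s x).symm⟩

theorem omegaLimitSet_nonempty {φ : ℝ → M → M} {x : M} {C : Set M} (hC : IsCompact C)
    (h : ∀ t, 0 ≤ t → φ t x ∈ C) : (omegaLimitSet φ x).Nonempty := by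
  obtain ⟨y, -, hy⟩ := hC (f := map (fun t => φ t x) atTop)
    (le_principal_iff.2 ((eventually_ge_atTop 0).mono h))
  refine ⟨y, mem_omegaLimitSet.2 fun T _ => ?_⟩
  exact mem_closure_iff_clusterPt.2
    (hy.mono (le_principal_iff.2 (image_mem_map (Ici_mem_atTop T))))

/-- If the ω-limit set of a point meets a Lyapunov stable compact set, it lies inside that set. -/
theorem IsLyapunovStable.omegaLimitSet_subset [LocallyCompactSpace M] {φ : ℝ → M → M} {Λ : Set M}
    (hstab : IsLyapunovStable φ Λ) (hΛ : IsCompact Λ)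
    (hadd : ∀ s t : ℝ, ∀ x : M, φ s (φ t x) = φ (s + t) x) {x : M}
    (hmeet : (omegaLimitSet φ x ∩ Λ).Nonempty) : omegaLimitSet φ x ⊆ Λ := by
  obtain ⟨p, hpω, hpΛ⟩ := hmeet
  intro y hy
  by_contra hyΛ
  obtain ⟨C, hC, hΛC, hCy⟩ := exists_compact_between hΛ isOpen_compl_singleton
    (subset_compl_singleton_iff.2 hyΛ)
  obtain ⟨V, hV, hVC, hVinv⟩ := hstab C (subset_interior_iff_mem_nhdsSet.1 hΛC)
  obtain ⟨_, hTV, T, hT, rfl⟩ := mem_closure_iff_nhds.1 (mem_omegaLimitSet.1 hpω 0 le_rfl) V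
    (mem_nhdsSet_iff_forall.1 hV p hpΛ)
  refine hCy (omegaLimitSet_subset_of_isClosed hC.isClosed hT (fun t ht => hVC ?_) hy) rfl
  simpa [hadd] using hVinv _ hTV (t - T) (sub_nonneg.2 ht)

theorem isolated_stable_minimal_is_attractor [LocallyCompactSpace M] [ConnectedSpace M] [LocallyConnectedSpace M]
    (φ : ℝ → M → M)
    (hφcont : Continuous fun p : ℝ × M => φ p.1 p.2)
    (hφzero : ∀ x : M, φ 0 x = x)
    (hφadd : ∀ s t : ℝ, ∀ x : M, φ s (φ t x) = φ (s + t) x)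
    (Λ : Set M) (hΛ : IsCompactMinimalSet φ Λ) (hstab : IsLyapunovStable φ Λ)
    (hiso : ∃ W ∈ 𝓝ˢ Λ, ∀ Γ : Set M, IsCompactMinimalSet φ Γ → Γ ⊆ W → Γ = Λ) :
    IsAttractorSet φ Λ := by
  obtain ⟨W, hW, hWiso⟩ := hiso
  have hcont : ∀ t, Continuous (φ t) := fun t => hφcont.comp (Continuous.prodMk_right t)
  refine ⟨hΛ.1, hΛ.2.1, hΛ.2.2.1, hstab, ?_⟩
  obtain ⟨C, hC, hΛC, hCW⟩ := exists_compact_between hΛ.2.1 isOpen_interior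
    (subset_interior_iff_mem_nhdsSet.2 hW)
  obtain ⟨V, hV, hVC, hVinv⟩ := hstab C (subset_interior_iff_mem_nhdsSet.1 hΛC)
  refine mem_of_superset hV fun x hx => ?_
  have horb : ∀ t, 0 ≤ t → φ t x ∈ C := fun t ht => hVC (hVinv x hx t ht)
  have hne : (omegaLimitSet φ x).Nonempty := omegaLimitSet_nonempty hC horb
  have hωC : omegaLimitSet φ x ⊆ C := omegaLimitSet_subset_of_isClosed hC.isClosed le_rfl horb
  obtain ⟨Γ, hΓω, hΓ⟩ :=
    (isFlowInvariant_omegaLimitSet hcont hφadd x).exists_isCompactMinimalSet_subset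
      (hC.of_isClosed_subset (isClosed_omegaLimitSet φ x) hωC) hne
  obtain rfl : Γ = Λ := hWiso Γ hΓ ((hΓω.trans hωC).trans (hCW.trans interior_subset))
  exact ⟨hne, hstab.omegaLimitSet_subset hΛ.2.1 hφadd
    (hΛ.1.mono (subset_inter hΓω Subset.rfl))⟩
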